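/- Let C be a binary linear code of length n. Then the set of leader codewords L(C) = {n1 + n2 + e_i in C \ {0} : i not in supp(n1), n1, n2 in CL(C)} coincides with the set {n1 + n2 + e_i in C \ {0} : i not in supp(n1), n1, n2 in CL(C), and w_H(n1 + e_i) > w_H(n2)}. -/

import Mathlib

/-- `w` is a coset leader of the binary code `C`: it has minimal Hamming weight
in its coset `w + C`. -/
def IsCosetLeader {n : ℕ} (C : Submodule (ZMod 2) (Fin n → ZMod 2))
    (w : Fin n → ZMod 2) : Prop :=
  ∀ v : Fin n → ZMod 2, w - v ∈ C → hammingNorm w ≤ hammingNorm v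

theorem hammingNorm_add_single {n : ℕ} {w : Fin n → ZMod 2} {i : Fin n} (h : w i = 0) :
    hammingNorm (w + Pi.single i 1) = hammingNorm w + 1 := by
  have hs : (Finset.univ.filter fun j => (w + Pi.single i 1 : Fin n → ZMod 2) j ≠ 0)
      = insert i (Finset.univ.filter fun j => w j ≠ 0) := by
    ext j
    by_cases hj : j = i
    · subst hj
      simp [h]
    · simp [hj]
  unfold hammingNorm
  rw [hs, Finset.card_insert_of_notMem (by simp [h])]

theorem ZMod.two_add_cancel_right {ι : Type*} (x y : ι → ZMod 2) : x + y + y = x := by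
  rw [add_assoc, ZModModule.add_self, add_zero]

theorem hammingNorm_add_single_add_one {n : ℕ} {w : Fin n → ZMod 2} {i : Fin n} (h : w i ≠ 0) :
    hammingNorm (w + Pi.single i 1) + 1 = hammingNorm w := by
  have h0 : (w + Pi.single i 1 : Fin n → ZMod 2) i = 0 := by
    have h1 : w i = 1 := Fin.eq_one_of_ne_zero _ h
    simp [h1, CharTwo.add_self_eq_zero]
  rw [← hammingNorm_add_single h0, ZMod.two_add_cancel_right]

theorem hammingNorm_add_single_le {n : ℕ} (w : Fin n → ZMod 2) (i : Fin n) :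
    hammingNorm (w + Pi.single i 1) ≤ hammingNorm w + 1 := by
  by_cases h : w i = 0
  · exact (hammingNorm_add_single h).le
  · have := hammingNorm_add_single_add_one h
    omega

/-- Removing a coordinate from the support of a coset leader leaves a coset leader. -/
theorem IsCosetLeader.add_single {n : ℕ} {C : Submodule (ZMod 2) (Fin n → ZMod 2)}
    {w : Fin n → ZMod 2} (hw : IsCosetLeader C w) {i : Fin n} (h : w i ≠ 0) :
    IsCosetLeader C (w + Pi.single i 1) := by
  intro v hv
  have h1 := hw (v + Pi.single i 1) (by
    rwa [← sub_sub, sub_right_comm, ZModModule.sub_eq_add w])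
  have h2 := hammingNorm_add_single_le v i
  have h3 := hammingNorm_add_single_add_one h
  omega

/-- A word of the same coset and of no larger weight than a coset leader is a coset leader. -/
theorem IsCosetLeader.of_sub_mem {n : ℕ} {C : Submodule (ZMod 2) (Fin n → ZMod 2)}
    {w u : Fin n → ZMod 2} (hw : IsCosetLeader C w) (h : w - u ∈ C)
    (hle : hammingNorm u ≤ hammingNorm w) : IsCosetLeader C u := fun v hv =>
  hle.trans (hw v (by simpa using C.add_mem h hv))

theorem exists_ne_zero_and_eq_zero_of_hammingNorm_le {n : ℕ} {u v : Fin n → ZMod 2}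
    (hne : u ≠ v) (hle : hammingNorm u ≤ hammingNorm v) : ∃ j, v j ≠ 0 ∧ u j = 0 := by
  by_contra! hsub
  have hs : (Finset.univ.filter fun j => v j ≠ 0) = Finset.univ.filter fun j => u j ≠ 0 :=
    Finset.eq_of_subset_of_card_le
      (fun j hj => by simpa using hsub j (by simpa using hj)) hle
  refine hne (funext fun j => ?_)
  have hj : v j ≠ 0 ↔ u j ≠ 0 := by simpa using Finset.ext_iff.mp hs j
  by_cases h : v j = 0
  · rw [h]
    exact not_not.mp fun hu => hj.mpr hu h
  · rw [Fin.eq_one_of_ne_zero _ h, Fin.eq_one_of_ne_zero _ (hj.mp h)]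

theorem stmt_14 {n : ℕ} (C : Submodule (ZMod 2) (Fin n → ZMod 2)) :
    {c : Fin n → ZMod 2 | c ∈ C ∧ c ≠ 0 ∧
        ∃ (n1 n2 : Fin n → ZMod 2) (i : Fin n),
          IsCosetLeader C n1 ∧ IsCosetLeader C n2 ∧ n1 i = 0 ∧
          c = n1 + n2 + Pi.single i 1}
      = {c : Fin n → ZMod 2 | c ∈ C ∧ c ≠ 0 ∧
        ∃ (n1 n2 : Fin n → ZMod 2) (i : Fin n),
          IsCosetLeader C n1 ∧ IsCosetLeader C n2 ∧ n1 i = 0 ∧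
          hammingNorm n2 < hammingNorm (n1 + Pi.single i 1) ∧
          c = n1 + n2 + Pi.single i 1} := by
  ext c
  constructor
  · rintro ⟨hc, hc0, n1, n2, i, h1, h2, hi, rfl⟩
    refine ⟨hc, hc0, ?_⟩
    have hmem : n2 - (n1 + Pi.single i 1) ∈ C := by
      rw [ZModModule.sub_eq_add]
      convert hc using 1
      abel
    rcases (h2 _ hmem).lt_or_eq with hlt | heq
    · exact ⟨n1, n2, i, h1, h2, hi, hlt, rfl⟩
    have hne : n1 + Pi.single i 1 ≠ n2 := by
      intro h
      apply hc0
      rw [add_right_comm, h, ZModModule.add_self]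
    obtain ⟨j, hj2, hj1⟩ := exists_ne_zero_and_eq_zero_of_hammingNorm_le hne heq.ge
    refine ⟨n1 + Pi.single i 1, n2 + Pi.single j 1, j, h2.of_sub_mem hmem heq.ge,
      h2.add_single hj2, hj1, ?_, ?_⟩
    · have h3 := hammingNorm_add_single hj1
      have h4 := hammingNorm_add_single_add_one hj2
      omega
    · rw [← add_assoc, ZMod.two_add_cancel_right, add_right_comm]
  · rintro ⟨hc, hc0, n1, n2, i, h1, h2, hi, -, h⟩
    exact ⟨hc, hc0, n1, n2, i, h1, h2, hi, h⟩
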